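/- arXiv:2407.02108 — 3 statements merged into one kernel-verified Lean document; each statement's English description precedes it below -/
import Mathlib

section
/- Let n ≥ 1 and μ ∈ [0,1] be real numbers with μ² ≤ 1 − 1/n² (total internal reflection regime). Set A := 1 − (1 + n⁻²)μ², Γ₃₃ := 1 − 2(1−μ²)²/A and Γ₄₃ := 2μ(1−μ²)√(1 − 1/n² − μ²)/A. Then A > 0 and Γ₃₃² + Γ₄₃² = 1. -/
theorem stmt6 (n μ A Γ33 Γ43 : ℝ)
    (hn : 1 ≤ n) (hμ : μ ∈ Set.Icc (0 : ℝ) 1)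
    (htir : μ ^ 2 ≤ 1 - 1 / n ^ 2)
    (hA : A = 1 - (1 + n⁻¹ ^ 2) * μ ^ 2)
    (hΓ33 : Γ33 = 1 - 2 * (1 - μ ^ 2) ^ 2 / A)
    (hΓ43 : Γ43 = 2 * μ * (1 - μ ^ 2) * Real.sqrt (1 - 1 / n ^ 2 - μ ^ 2) / A) :
    0 < A ∧ Γ33 ^ 2 + Γ43 ^ 2 = 1 := by
  have hk : 1 / n ^ 2 = n⁻¹ ^ 2 := by rw [inv_pow, one_div]
  rw [hk] at htir hΓ43
  have hk0 : 0 < n⁻¹ ^ 2 := by positivity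
  generalize n⁻¹ ^ 2 = k at *
  have hm : 0 < 1 - μ ^ 2 := by linarith
  have hA0 : 0 < A := by
    rw [hA]
    nlinarith [mul_nonneg (sq_nonneg μ) (sub_nonneg.2 htir), mul_pos hm hm]
  refine ⟨hA0, ?_⟩
  have hs : Real.sqrt (1 - k - μ ^ 2) ^ 2 = 1 - k - μ ^ 2 :=
    Real.sq_sqrt (by linarith)
  have h3 : (1 - μ ^ 2) ^ 2 = A - μ ^ 2 * (1 - k - μ ^ 2) := by rw [hA]; ring
  have h43 : Γ43 ^ 2 = 4 * μ ^ 2 * (1 - μ ^ 2) ^ 2 * (1 - k - μ ^ 2) / A ^ 2 := by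
    rw [hΓ43, div_pow, mul_pow, hs]; ring
  rw [h43, hΓ33, h3]
  field_simp
  ring
end

section
/- Let 0 < Y < Z, let h, s : [0, Z] → ℝ be continuous, define φ(a, b) := exp(−∫_a^b h(y) dy), and let A, Δ ∈ ℝ. Suppose v : [0, Y] → ℝ satisfies v(z) = φ(0, z)·A + ∫₀^z φ(z', z)·s(z') dz' for all z ∈ [0, Y], and w : [Y, Z] → ℝ satisfies w(z) = φ(Y, z)·w(Y) + ∫_Y^z φ(z', z)·s(z') dz' for all z ∈ [Y, Z], where the jump condition w(Y) = v(Y) + Δ holds. Then for all z ∈ [Y, Z], w(z) = φ(0, z)·A + ∫₀^z φ(z', z)·s(z') dz' + φ(Y, z)·Δ. -/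
open intervalIntegral

theorem stmt10 (Y Z : ℝ) (hY : 0 < Y) (hYZ : Y < Z)
    (h s : ℝ → ℝ)
    (hh : ContinuousOn h (Set.Icc 0 Z)) (hs : ContinuousOn s (Set.Icc 0 Z))
    (φ : ℝ → ℝ → ℝ)
    (hφ : φ = fun a b => Real.exp (-∫ y in a..b, h y))
    (A Δ : ℝ) (v w : ℝ → ℝ)
    (hv : ∀ z ∈ Set.Icc 0 Y, v z = φ 0 z * A + ∫ z' in (0 : ℝ)..z, φ z' z * s z')
    (hw : ∀ z ∈ Set.Icc Y Z, w z = φ Y z * w Y + ∫ z' in Y..z, φ z' z * s z')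
    (hjump : w Y = v Y + Δ) :
    ∀ z ∈ Set.Icc Y Z,
      w z = φ 0 z * A + (∫ z' in (0 : ℝ)..z, φ z' z * s z') + φ Y z * Δ := by
  intro z hz
  obtain ⟨hz1, hz2⟩ := hz
  have hZ : (0:ℝ) ≤ Z := by linarith
  have hint : ∀ a ∈ Set.Icc 0 Z, ∀ b ∈ Set.Icc 0 Z,
      IntervalIntegrable h MeasureTheory.volume a b := by
    intro a ha b hb
    exact (hh.mono (Set.uIcc_subset_Icc ha hb)).intervalIntegrable
  have m0 : (0:ℝ) ∈ Set.Icc 0 Z := ⟨le_refl _, hZ⟩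
  have mY : Y ∈ Set.Icc 0 Z := ⟨hY.le, hYZ.le⟩
  have mz : z ∈ Set.Icc 0 Z := ⟨by linarith, hz2⟩
  have mZ : Z ∈ Set.Icc 0 Z := ⟨hZ, le_refl _⟩
  have hmul : ∀ a ∈ Set.Icc 0 Z, φ Y z * φ a Y = φ a z := by
    intro a ha
    simp only [hφ]
    rw [← Real.exp_add, ← integral_add_adjacent_intervals (hint a ha Y mY) (hint Y mY z mz)]
    congr 1
    ring
  have hcont : ContinuousOn (fun a => φ a z * s a) (Set.Icc 0 Z) := by
    refine ContinuousOn.mul ?_ hs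
    have h1 := continuousOn_primitive_interval' (hint 0 m0 Z mZ)
      (a := z) (by rw [Set.uIcc_of_le hZ]; exact mz)
    rw [Set.uIcc_of_le hZ] at h1
    refine (Real.continuous_exp.comp_continuousOn h1).congr ?_
    intro a _
    simp only [hφ, Function.comp]
    rw [integral_symm z a, neg_neg]
  have hi : ∀ a ∈ Set.Icc 0 Z, ∀ b ∈ Set.Icc 0 Z,
      IntervalIntegrable (fun a => φ a z * s a) MeasureTheory.volume a b := by
    intro a ha b hb
    exact (hcont.mono (Set.uIcc_subset_Icc ha hb)).intervalIntegrable
  have hpull : φ Y z * (∫ z' in (0:ℝ)..Y, φ z' Y * s z') = ∫ z' in (0:ℝ)..Y, φ z' z * s z' := by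
    rw [← integral_const_mul]
    refine integral_congr ?_
    intro a ha
    have ha2 := Set.uIcc_subset_Icc m0 mY ha
    simp only
    rw [← mul_assoc, hmul a ha2]
  rw [hw z ⟨hz1, hz2⟩, hjump, hv Y ⟨hY.le, le_refl _⟩,
    ← integral_add_adjacent_intervals (hi 0 m0 Y mY) (hi Y mY z mz), ← hpull, ← hmul 0 m0]
  ring
end

section
/- Let Z > 0, β ∈ [0,1], and let κ_a, κ_s, b, L : [0, Z] → ℝ be continuous with κ := κ_a + κ_s. Let I, Q : [0, Z] × [−1, 1] → ℝ be continuous, with ∂_z I existing and jointly continuous, and with μ ↦ (1−μ²)·I(z,μ) continuously differentiable in μ for each z. Suppose that for all z ∈ (0, Z) and μ ∈ [−1, 1], μ·∂_z I(z,μ) + L(z)·∂_μ[(1−μ²)·I(z,μ)] + κ(z)·I(z,μ) = κ_a(z)·b(z) + (κ_s(z)/2)·∫_{−1}^{1} I(z,μ') dμ' + (β·κ_s(z)/4)·P₂(μ)·∫_{−1}^{1} [P₂(μ')·I(z,μ') − (1 − P₂(μ'))·Q(z,μ')] dμ', where P₂(μ) = (3μ² − 1)/2. Then for every z ∈ (0,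 Z), the radiative flux F(z) := (1/2)∫_{−1}^{1} μ·I(z,μ) dμ is differentiable with F'(z) = κ_a(z)·( b(z) − (1/2)∫_{−1}^{1} I(z,μ) dμ ). -/
open intervalIntegral Set

theorem stmt13 (Z β : ℝ) (hZ : 0 < Z) (hβ : β ∈ Set.Icc (0 : ℝ) 1)
    (κa κs b L : ℝ → ℝ)
    (hκa : ContinuousOn κa (Set.Icc 0 Z)) (hκs : ContinuousOn κs (Set.Icc 0 Z))
    (hb : ContinuousOn b (Set.Icc 0 Z)) (hL : ContinuousOn L (Set.Icc 0 Z))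
    (I Q : ℝ → ℝ → ℝ)
    (hI : ContinuousOn (fun p : ℝ × ℝ => I p.1 p.2)
      (Set.Icc 0 Z ×ˢ Set.Icc (-1 : ℝ) 1))
    (hQ : ContinuousOn (fun p : ℝ × ℝ => Q p.1 p.2)
      (Set.Icc 0 Z ×ˢ Set.Icc (-1 : ℝ) 1))
    (Iz : ℝ → ℝ → ℝ)  -- ∂_z I
    (hIz : ∀ z ∈ Set.Ioo (0 : ℝ) Z, ∀ μ ∈ Set.Icc (-1 : ℝ) 1,
      HasDerivAt (fun t => I t μ) (Iz z μ) z)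
    (hIzc : ContinuousOn (fun p : ℝ × ℝ => Iz p.1 p.2)
      (Set.Icc 0 Z ×ˢ Set.Icc (-1 : ℝ) 1))
    (Im : ℝ → ℝ → ℝ)  -- ∂_μ ((1-μ²) I)
    (hIm : ∀ z ∈ Set.Icc (0 : ℝ) Z, ∀ μ ∈ Set.Icc (-1 : ℝ) 1,
      HasDerivAt (fun m => (1 - m ^ 2) * I z m) (Im z μ) μ)
    (hImc : ∀ z ∈ Set.Icc (0 : ℝ) Z, ContinuousOn (fun μ => Im z μ) (Set.Icc (-1 : ℝ) 1))
    (P₂ : ℝ → ℝ) (hP₂ : P₂ = fun μ => (3 * μ ^ 2 - 1) / 2)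
    (hPDE : ∀ z ∈ Set.Ioo (0 : ℝ) Z, ∀ μ ∈ Set.Icc (-1 : ℝ) 1,
      μ * Iz z μ + L z * Im z μ + (κa z + κs z) * I z μ
        = κa z * b z + (κs z / 2) * (∫ μ' in (-1 : ℝ)..1, I z μ')
          + (β * κs z / 4) * P₂ μ *
            (∫ μ' in (-1 : ℝ)..1, (P₂ μ' * I z μ' - (1 - P₂ μ') * Q z μ'))) :
    ∀ z ∈ Set.Ioo (0 : ℝ) Z,
      HasDerivAt (fun t => (1 / 2) * ∫ μ in (-1 : ℝ)..1, μ * I t μ)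
        (κa z * (b z - (1 / 2) * ∫ μ in (-1 : ℝ)..1, I z μ)) z := by
  intro z hz
  have hzc : z ∈ Set.Icc (0:ℝ) Z := Set.Ioo_subset_Icc_self hz
  have hu : Set.uIcc (-1:ℝ) 1 = Set.Icc (-1) 1 := Set.uIcc_of_le (by norm_num)
  have hu' : Set.uIoc (-1:ℝ) 1 ⊆ Set.Icc (-1) 1 := by
    rw [Set.uIoc_of_le (by norm_num)]; exact Set.Ioc_subset_Icc_self
  have hslice : ∀ G : ℝ → ℝ → ℝ, ContinuousOn (fun p : ℝ × ℝ => G p.1 p.2)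
      (Set.Icc 0 Z ×ˢ Set.Icc (-1 : ℝ) 1) → ∀ t ∈ Set.Icc (0:ℝ) Z,
      ContinuousOn (fun m => G t m) (Set.Icc (-1:ℝ) 1) := by
    intro G hG t ht
    exact hG.comp (f := fun m : ℝ => (t, m)) (by fun_prop) (fun m hm => ⟨ht, hm⟩)
  have hint : ∀ g : ℝ → ℝ, ContinuousOn g (Set.Icc (-1:ℝ) 1) →
      IntervalIntegrable g MeasureTheory.volume (-1) 1 := by
    intro g hg
    exact ContinuousOn.intervalIntegrable (by rwa [hu])
  obtain ⟨C, hC⟩ := (isCompact_Icc.prod isCompact_Icc).exists_bound_of_continuousOn hIzc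
  have hmI : ∀ t ∈ Set.Icc (0:ℝ) Z, IntervalIntegrable (fun m => m * I t m)
      MeasureTheory.volume (-1) 1 := fun t ht =>
    hint _ (continuousOn_id.mul (hslice I hI t ht))
  have hnhds : Set.Ioo 0 Z ∈ nhds z := Ioo_mem_nhds hz.1 hz.2
  have hD : HasDerivAt (fun t => ∫ m in (-1:ℝ)..1, m * I t m)
      (∫ m in (-1:ℝ)..1, m * Iz z m) z := by
    refine (intervalIntegral.hasDerivAt_integral_of_dominated_loc_of_deriv_le
      (F := fun t m => m * I t m) (F' := fun t m => m * Iz t m) (bound := fun _ => C)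
      hnhds ?_ (hmI z hzc) ?_ ?_ ?_ ?_).2
    · filter_upwards [hnhds] with t ht
      exact (hmI t (Set.Ioo_subset_Icc_self ht)).def'.aestronglyMeasurable
    · exact (hint _ (continuousOn_id.mul (hslice Iz hIzc z hzc))).def'.aestronglyMeasurable
    · refine Filter.Eventually.of_forall fun m hm t ht => ?_
      have h1 := hC (t, m) ⟨Set.Ioo_subset_Icc_self ht, hu' hm⟩
      have h2 : |m| ≤ 1 := abs_le.2 (hu' hm)
      simp only [Real.norm_eq_abs, abs_mul] at h1 ⊢
      nlinarith [abs_nonneg (Iz t m), abs_nonneg m]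
    · exact intervalIntegrable_const
    · refine Filter.Eventually.of_forall fun m hm t ht => ?_
      exact (hIz t ht m (hu' hm)).const_mul m
  have hImint : ∫ m in (-1:ℝ)..1, Im z m = 0 := by
    rw [intervalIntegral.integral_eq_sub_of_hasDerivAt
      (f := fun m => (1 - m ^ 2) * I z m) (fun m hm => hIm z hzc m (hu ▸ hm))
      (hint _ (hImc z hzc))]
    norm_num
  have hPint : ∫ m in (-1:ℝ)..1, P₂ m = 0 := by
    rw [hP₂]
    simp only [intervalIntegral.integral_div]
    rw [intervalIntegral.integral_sub (by apply Continuous.intervalIntegrable; fun_prop)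
      (by simp), intervalIntegral.integral_const_mul, integral_pow]
    norm_num
  have iP : IntervalIntegrable P₂ MeasureTheory.volume (-1) 1 := by
    rw [hP₂]; apply Continuous.intervalIntegrable; fun_prop
  have iI := hint _ (hslice I hI z hzc)
  have iM := hint _ (hImc z hzc)
  set J := ∫ m in (-1:ℝ)..1, I z m with hJ
  set K := ∫ μ' in (-1 : ℝ)..1, (P₂ μ' * I z μ' - (1 - P₂ μ') * Q z μ') with hK
  have key : ∫ m in (-1:ℝ)..1, m * Iz z m
      = 2 * (κa z * (b z - (1 / 2) * J)) := by
    have e : ∫ m in (-1:ℝ)..1, m * Iz z m = ∫ m in (-1:ℝ)..1,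
        ((κa z * b z + (κs z / 2) * J) + ((β * κs z / 4) * K) * P₂ m
          - L z * Im z m - (κa z + κs z) * I z m) := by
      apply intervalIntegral.integral_congr
      intro m hm
      have := hPDE z hz m (hu ▸ hm)
      simp only
      linarith
    rw [e, intervalIntegral.integral_sub
        ((intervalIntegrable_const.add (iP.const_mul _)).sub (iM.const_mul _)) (iI.const_mul _),
      intervalIntegral.integral_sub
        (intervalIntegrable_const.add (iP.const_mul _)) (iM.const_mul _),
      intervalIntegral.integral_add intervalIntegrable_const (iP.const_mul _)]
    simp only [intervalIntegral.integral_const_mul, intervalIntegral.integral_const, hImint,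
      hPint, ← hJ, smul_eq_mul]
    ring
  have := hD.const_mul (1 / 2 : ℝ)
  rw [key] at this
  refine this.congr_deriv ?_
  ring
end
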